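/- Let M and N be Lie superalgebras over a field of characteristic ≠ 2, 3 that act trivially on each other. Then there is an isomorphism M ⊗ N ≅ M^{ab} ⊗_mod N^{ab}, where M^{ab} = M/[M, M], N^{ab} = N/[N, N], and ⊗_mod denotes the ordinary tensor product of supermodules. -/

import Mathlib

open Module Function TensorProduct

universe u v w x y z

/-- The sign `(-1)^(ab)` for degrees `a b : ZMod 2`, as an element of the field `F`. -/
def sgn (F : Type u) [Field F] (a b : ZMod 2) : F :=
  if a = 1 ∧ b = 1 then -1 else 1

/-- A supermodule (ℤ/2-graded vector space) over `F`. -/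
class SuperModule (F : Type u) (V : Type v) [Field F] [AddCommGroup V] [Module F V] where
  grade : ZMod 2 → Submodule F V
  isCompl_grade : IsCompl (grade 0) (grade 1)

/-- The graded piece of degree `a`. -/
abbrev gr (F : Type u) (V : Type v) [Field F] [AddCommGroup V] [Module F V]
    [s : SuperModule F V] (a : ZMod 2) : Submodule F V := s.grade a

/-- A Lie superalgebra structure on a supermodule. -/
class LieSuperAlgebra (F : Type u) (L : Type v) [Field F] [AddCommGroup L] [Module F L]
    [SuperModule F L] where
  bracket : L →ₗ[F] L →ₗ[F] L
  bracket_grade : ∀ (a b : ZMod 2) (x y : L), x ∈ gr F L a → y ∈ gr F L b →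
    bracket x y ∈ gr F L (a + b)
  skew : ∀ (a b : ZMod 2) (x y : L), x ∈ gr F L a → y ∈ gr F L b →
    bracket x y = -(sgn F a b) • bracket y x
  jacobi : ∀ (a b c : ZMod 2) (x y zz : L), x ∈ gr F L a → y ∈ gr F L b → zz ∈ gr F L c →
    sgn F a c • bracket x (bracket y zz) + sgn F b a • bracket y (bracket zz x)
      + sgn F c b • bracket zz (bracket x y) = 0

/-- The bracket of a Lie superalgebra. -/
abbrev br (F : Type u) (L : Type v) [Field F] [AddCommGroup L] [Module F L] [SuperModule F L]
    [s : LieSuperAlgebra F L] : L →ₗ[F] L →ₗ[F] L := s.bracket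

/-- A graded submodule. -/
def IsGradedSub (F : Type u) {V : Type v} [Field F] [AddCommGroup V] [Module F V]
    [SuperModule F V] (N : Submodule F V) : Prop :=
  N ≤ (N ⊓ gr F V 0) ⊔ (N ⊓ gr F V 1)

section LSADefs

variable (F : Type u) [Field F]
variable (L : Type v) [AddCommGroup L] [Module F L] [SuperModule F L] [LieSuperAlgebra F L]

/-- The derived subalgebra `L² = [L, L]`. -/
def derivedSub : Submodule F L := Submodule.span F {t | ∃ x y : L, br F L x y = t}

/-- The center `Z(L)`. -/
def centerSub : Submodule F L := ⨅ x : L, LinearMap.ker ((br F L).flip x)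

/-- The span of brackets `[A, B]` of two submodules. -/
def bracketSub (A B : Submodule F L) : Submodule F L :=
  Submodule.span F {t | ∃ x ∈ A, ∃ y ∈ B, br F L x y = t}

/-- Abelian Lie superalgebra. -/
def IsAbelianLSA : Prop := ∀ x y : L, br F L x y = 0

/-- The lower central series. -/
def lcs : ℕ → Submodule F L
  | 0 => ⊤
  | n + 1 => Submodule.span F {t | ∃ x : L, ∃ y ∈ lcs n, br F L x y = t}

/-- Nilpotent Lie superalgebra. -/
def IsNilpotentLSA : Prop := ∃ n : ℕ, lcs F L n = ⊥

end LSADefs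

/-- Homomorphism of Lie superalgebras: an even linear map preserving grading and bracket. -/
structure LieSuperHom (F : Type u) (L : Type v) (M : Type w) [Field F]
    [AddCommGroup L] [Module F L] [SuperModule F L] [LieSuperAlgebra F L]
    [AddCommGroup M] [Module F M] [SuperModule F M] [LieSuperAlgebra F M]
    extends L →ₗ[F] M where
  map_grade : ∀ (a : ZMod 2) (x : L), x ∈ gr F L a → toLinearMap x ∈ gr F M a
  map_bracket : ∀ x y : L, toLinearMap (br F L x y) = br F M (toLinearMap x) (toLinearMap y)

/-- Isomorphism of Lie superalgebras. -/
def LSAIsomorphic (F : Type u) (L : Type v) (M : Type w) [Field F]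
    [AddCommGroup L] [Module F L] [SuperModule F L] [LieSuperAlgebra F L]
    [AddCommGroup M] [Module F M] [SuperModule F M] [LieSuperAlgebra F M] : Prop :=
  ∃ f : LieSuperHom F L M, Function.Bijective f.toLinearMap

/-- `Q` is (a realization of) the quotient `L / L²`, i.e. the abelianization of `L`. -/
def IsQuotientByDerived (F : Type u) (L : Type v) (Q : Type w) [Field F]
    [AddCommGroup L] [Module F L] [SuperModule F L] [LieSuperAlgebra F L]
    [AddCommGroup Q] [Module F Q] [SuperModule F Q] [LieSuperAlgebra F Q] : Prop :=
  ∃ f : LieSuperHom F L Q, Function.Surjective f.toLinearMap ∧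
    LinearMap.ker f.toLinearMap = derivedSub F L

/-- An action of the Lie superalgebra `P` on the Lie superalgebra `M`. -/
structure LieSuperAction (F : Type u) (P : Type v) (M : Type w) [Field F]
    [AddCommGroup P] [Module F P] [SuperModule F P] [LieSuperAlgebra F P]
    [AddCommGroup M] [Module F M] [SuperModule F M] [LieSuperAlgebra F M] where
  act : P →ₗ[F] M →ₗ[F] M
  act_grade : ∀ (a b : ZMod 2) (p : P) (m : M), p ∈ gr F P a → m ∈ gr F M b →
    act p m ∈ gr F M (a + b)
  act_bracket : ∀ (a b : ZMod 2) (p p' : P) (m : M), p ∈ gr F P a → p' ∈ gr F P b →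
    act (br F P p p') m = act p (act p' m) - sgn F a b • act p' (act p m)
  act_lie : ∀ (a b : ZMod 2) (p : P) (m m' : M), p ∈ gr F P a → m ∈ gr F M b →
    act p (br F M m m') = br F M (act p m) m' + sgn F a b • br F M m (act p m')

/-- A trivial action. -/
def LieSuperAction.IsTrivial {F : Type u} {P : Type v} {M : Type w} [Field F]
    [AddCommGroup P] [Module F P] [SuperModule F P] [LieSuperAlgebra F P]
    [AddCommGroup M] [Module F M] [SuperModule F M] [LieSuperAlgebra F M]
    (α : LieSuperAction F P M) : Prop := ∀ (p : P) (m : M), α.act p m = 0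

/-- The trivial action of `P` on `M`. -/
def trivialAction (F : Type u) (P : Type v) (M : Type w) [Field F]
    [AddCommGroup P] [Module F P] [SuperModule F P] [LieSuperAlgebra F P]
    [AddCommGroup M] [Module F M] [SuperModule F M] [LieSuperAlgebra F M] :
    LieSuperAction F P M where
  act := 0
  act_grade := by
    intro a b p m _ _
    simp only [LinearMap.zero_apply]
    exact (gr F M (a + b)).zero_mem
  act_bracket := by intro a b p p' m _ _; simp
  act_lie := by intro a b p m m' _ _; simp

/-- A Lie superpairing on `M × N` (relative to mutual actions) with values in the
Lie superalgebra `T`; these are exactly the defining relations of the non-abelian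
tensor product `M ⊗ N`. -/
structure SuperPairing (F : Type u) (M : Type v) (N : Type w) (T : Type x) [Field F]
    [AddCommGroup M] [Module F M] [SuperModule F M] [LieSuperAlgebra F M]
    [AddCommGroup N] [Module F N] [SuperModule F N] [LieSuperAlgebra F N]
    [AddCommGroup T] [Module F T] [SuperModule F T] [LieSuperAlgebra F T]
    (α : LieSuperAction F M N) (β : LieSuperAction F N M) where
  pair : M →ₗ[F] N →ₗ[F] T
  pair_grade : ∀ (a b : ZMod 2) (m : M) (n : N), m ∈ gr F M a → n ∈ gr F N b →
    pair m n ∈ gr F T (a + b)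
  rel1 : ∀ (a b : ZMod 2) (m m' : M) (n : N), m ∈ gr F M a → m' ∈ gr F M b →
    pair (br F M m m') n = pair m (α.act m' n) - sgn F a b • pair m' (α.act m n)
  rel2 : ∀ (a b c : ZMod 2) (m : M) (n n' : N), m ∈ gr F M a → n ∈ gr F N b → n' ∈ gr F N c →
    pair m (br F N n n') = sgn F c (a + b) • pair (β.act n' m) n - sgn F a b • pair (β.act n m) n'
  rel3 : ∀ (a b : ZMod 2) (m : M) (n : N) (m' : M) (n' : N), m ∈ gr F M a → n ∈ gr F N b →
    br F T (pair m n) (pair m' n') = - sgn F a b • pair (β.act n m) (α.act m' n')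

/-- `T`, together with the pairing `p`, is (a realization of) the non-abelian tensor
product `M ⊗ N`: it satisfies the universal property among Lie superpairings. -/
def IsTensorProductLSA (F : Type u) (M : Type v) (N : Type w) (T : Type x) [Field F]
    [AddCommGroup M] [Module F M] [SuperModule F M] [LieSuperAlgebra F M]
    [AddCommGroup N] [Module F N] [SuperModule F N] [LieSuperAlgebra F N]
    [AddCommGroup T] [Module F T] [SuperModule F T] [LieSuperAlgebra F T]
    (α : LieSuperAction F M N) (β : LieSuperAction F N M)
    (p : SuperPairing F M N T α β) : Prop :=
  ∀ (T' : Type (max u v w x)) [AddCommGroup T'] [Module F T'] [SuperModule F T']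
    [LieSuperAlgebra F T'] (q : SuperPairing F M N T' α β),
    ∃! h : LieSuperHom F T T', ∀ (m : M) (n : N), h.toLinearMap (p.pair m n) = q.pair m n

/-- A Lie superpairing for the tensor square `L ⊗ L` (with adjoint actions):
the defining relations of the non-abelian tensor square. -/
structure TensorSqPairing (F : Type u) (L : Type v) (T : Type w) [Field F]
    [AddCommGroup L] [Module F L] [SuperModule F L] [LieSuperAlgebra F L]
    [AddCommGroup T] [Module F T] [SuperModule F T] [LieSuperAlgebra F T] where
  pair : L →ₗ[F] L →ₗ[F] T
  pair_grade : ∀ (a b : ZMod 2) (x y : L), x ∈ gr F L a → y ∈ gr F L b →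
    pair x y ∈ gr F T (a + b)
  rel1 : ∀ (a b : ZMod 2) (x x' y : L), x ∈ gr F L a → x' ∈ gr F L b →
    pair (br F L x x') y = pair x (br F L x' y) - sgn F a b • pair x' (br F L x y)
  rel2 : ∀ (a b c : ZMod 2) (x y y' : L), x ∈ gr F L a → y ∈ gr F L b → y' ∈ gr F L c →
    pair x (br F L y y') = sgn F c (a + b) • pair (br F L y' x) y
      - sgn F a b • pair (br F L y x) y'
  rel3 : ∀ (a b : ZMod 2) (x y x' y' : L), x ∈ gr F L a → y ∈ gr F L b →
    br F T (pair x y) (pair x' y') = - sgn F a b • pair (br F L y x) (br F L x' y')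

/-- `T`, together with the pairing `p`, is (a realization of) the non-abelian tensor
square `L ⊗ L`. -/
def IsTensorSquare (F : Type u) (L : Type v) (T : Type w) [Field F]
    [AddCommGroup L] [Module F L] [SuperModule F L] [LieSuperAlgebra F L]
    [AddCommGroup T] [Module F T] [SuperModule F T] [LieSuperAlgebra F T]
    (p : TensorSqPairing F L T) : Prop :=
  ∀ (T' : Type (max u v w)) [AddCommGroup T'] [Module F T'] [SuperModule F T']
    [LieSuperAlgebra F T'] (q : TensorSqPairing F L T'),
    ∃! h : LieSuperHom F T T', ∀ x y : L, h.toLinearMap (p.pair x y) = q.pair x y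

/-- The submodule `L □ L` of a realization `T` of `L ⊗ L`, generated by the elements
`x ⊗ x' + (-1)^{|x||x'|} (x' ⊗ x)` (homogeneous `x, x'`) and `x₀ ⊗ x₀` (`x₀` even). -/
def squareBox (F : Type u) (L : Type v) (T : Type w) [Field F]
    [AddCommGroup L] [Module F L] [SuperModule F L] [LieSuperAlgebra F L]
    [AddCommGroup T] [Module F T] [SuperModule F T] [LieSuperAlgebra F T]
    (p : TensorSqPairing F L T) : Submodule F T :=
  Submodule.span F
    ({t | ∃ (a b : ZMod 2) (x y : L), x ∈ gr F L a ∧ y ∈ gr F L b ∧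
        t = p.pair x y + sgn F a b • p.pair y x} ∪
      {t | ∃ x ∈ gr F L 0, t = p.pair x x})

/-- Data of a "universal quadratic functor" target: maps satisfying the defining
relations of `Γ(V)`. -/
structure GammaData (F : Type u) (V : Type v) (W : Type w) [Field F]
    [AddCommGroup V] [Module F V] [SuperModule F V] [AddCommGroup W] [Module F W] where
  gam : V → W
  bil : V →ₗ[F] V →ₗ[F] W
  gam_smul : ∀ (c : F) (v : V), v ∈ gr F V 0 → gam (c • v) = (c * c) • gam v
  gam_add : ∀ v w' : V, v ∈ gr F V 0 → w' ∈ gr F V 0 →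
    gam (v + w') - gam v - gam w' = bil v w'
  bil_symm : ∀ (a b : ZMod 2) (v w' : V), v ∈ gr F V a → w' ∈ gr F V b →
    bil v w' = sgn F a b • bil w' v
  bil_alt : ∀ v : V, v ∈ gr F V 1 → bil v v = 0

/-- `W`, with data `d`, is (a realization of) the universal quadratic functor `Γ(V)`. -/
def IsGamma (F : Type u) (V : Type v) (W : Type w) [Field F]
    [AddCommGroup V] [Module F V] [SuperModule F V] [AddCommGroup W] [Module F W]
    (d : GammaData F V W) : Prop :=
  ∀ (W' : Type (max u v w)) [AddCommGroup W'] [Module F W'] (d' : GammaData F V W'),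
    ∃! h : W →ₗ[F] W',
      (∀ v ∈ gr F V 0, h (d.gam v) = d'.gam v) ∧ (∀ v w' : V, h (d.bil v w') = d'.bil v w')

/-- `Fr` is a free Lie superalgebra on the graded set `(X, deg)` with inclusion `ι`. -/
def IsFreeLSA (F : Type u) (X : Type v) (deg : X → ZMod 2) (Fr : Type w) [Field F]
    [AddCommGroup Fr] [Module F Fr] [SuperModule F Fr] [LieSuperAlgebra F Fr]
    (ι : X → Fr) : Prop :=
  (∀ x : X, ι x ∈ gr F Fr (deg x)) ∧
  ∀ (K : Type (max u v w)) [AddCommGroup K] [Module F K] [SuperModule F K]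
    [LieSuperAlgebra F K] (f : X → K), (∀ x : X, f x ∈ gr F K (deg x)) →
    ∃! h : LieSuperHom F Fr K, ∀ x : X, h.toLinearMap (ι x) = f x

/-- Dimension of the degree-`a` part of the Schur multiplier `(R ∩ [Fr,Fr])/[Fr,R]`
attached to a free presentation with kernel `R`. -/
noncomputable def schurDim (F : Type u) (Fr : Type v) [Field F] [AddCommGroup Fr]
    [Module F Fr] [SuperModule F Fr] [LieSuperAlgebra F Fr]
    (R : Submodule F Fr) (a : ZMod 2) : ℕ :=
  finrank F ((R ⊓ derivedSub F Fr ⊓ gr F Fr a).map (bracketSub F Fr ⊤ R).mkQ)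

/-- `L` is (isomorphic to) the Heisenberg Lie superalgebra `H(m, n)` with even center:
it admits a homogeneous basis `x₁,…,x_{2m}, y₁,…,y_n, z` with the defining brackets. -/
def IsHmn (F : Type u) (m n : ℕ) (L : Type v) [Field F]
    [AddCommGroup L] [Module F L] [SuperModule F L] [LieSuperAlgebra F L] : Prop :=
  ∃ (xv : Fin (2 * m) → L) (yv : Fin n → L) (zv : L)
    (B : Basis ((Fin (2 * m)) ⊕ (Fin n) ⊕ Unit) F L),
    (∀ i, B (Sum.inl i) = xv i) ∧ (∀ j, B (Sum.inr (Sum.inl j)) = yv j) ∧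
    B (Sum.inr (Sum.inr ())) = zv ∧
    (∀ i, xv i ∈ gr F L 0) ∧ (∀ j, yv j ∈ gr F L 1) ∧ zv ∈ gr F L 0 ∧
    (∀ i j : Fin (2 * m), br F L (xv i) (xv j) =
      if (j : ℕ) = (i : ℕ) + m then zv else if (i : ℕ) = (j : ℕ) + m then -zv else 0) ∧
    (∀ (i : Fin (2 * m)) (j : Fin n), br F L (xv i) (yv j) = 0) ∧
    (∀ (j : Fin n) (i : Fin (2 * m)), br F L (yv j) (xv i) = 0) ∧
    (∀ j k : Fin n, br F L (yv j) (yv k) = if j = k then zv else 0) ∧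
    (∀ i, br F L (xv i) zv = 0) ∧ (∀ i, br F L zv (xv i) = 0) ∧
    (∀ j, br F L (yv j) zv = 0) ∧ (∀ j, br F L zv (yv j) = 0) ∧
    br F L zv zv = 0

/-- `L` is (isomorphic to) the Heisenberg Lie superalgebra `H_m` with odd center. -/
def IsHmOdd (F : Type u) (m : ℕ) (L : Type v) [Field F]
    [AddCommGroup L] [Module F L] [SuperModule F L] [LieSuperAlgebra F L] : Prop :=
  ∃ (xv yv : Fin m → L) (zv : L) (B : Basis ((Fin m) ⊕ (Fin m) ⊕ Unit) F L),
    (∀ i, B (Sum.inl i) = xv i) ∧ (∀ j, B (Sum.inr (Sum.inl j)) = yv j) ∧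
    B (Sum.inr (Sum.inr ())) = zv ∧
    (∀ i, xv i ∈ gr F L 0) ∧ (∀ j, yv j ∈ gr F L 1) ∧ zv ∈ gr F L 1 ∧
    (∀ i j, br F L (xv i) (xv j) = 0) ∧
    (∀ i j, br F L (xv i) (yv j) = if i = j then zv else 0) ∧
    (∀ i j, br F L (yv i) (xv j) = if i = j then -zv else 0) ∧
    (∀ i j, br F L (yv i) (yv j) = 0) ∧
    (∀ i, br F L (xv i) zv = 0) ∧ (∀ i, br F L zv (xv i) = 0) ∧
    (∀ j, br F L (yv j) zv = 0) ∧ (∀ j, br F L zv (yv j) = 0) ∧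
    br F L zv zv = 0

/-- `A` is (isomorphic to) the abelian Lie superalgebra `A(a | b)`. -/
def IsAbelianOfDim (F : Type u) (a b : ℕ) (A : Type v) [Field F]
    [AddCommGroup A] [Module F A] [SuperModule F A] [LieSuperAlgebra F A] : Prop :=
  IsAbelianLSA F A ∧ finrank F (gr F A 0) = a ∧ finrank F (gr F A 1) = b

/-- Heisenberg Lie superalgebra with even center: `Z(L) = L²` is one-dimensional,
spanned by a nonzero even element. -/
def IsHeisenbergEven (F : Type u) (L : Type v) [Field F]
    [AddCommGroup L] [Module F L] [SuperModule F L] [LieSuperAlgebra F L] : Prop :=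
  centerSub F L = derivedSub F L ∧
  ∃ zc : L, zc ≠ 0 ∧ zc ∈ gr F L 0 ∧ centerSub F L = Submodule.span F {zc}

/-- Heisenberg Lie superalgebra with odd center. -/
def IsHeisenbergOdd (F : Type u) (L : Type v) [Field F]
    [AddCommGroup L] [Module F L] [SuperModule F L] [LieSuperAlgebra F L] : Prop :=
  centerSub F L = derivedSub F L ∧
  ∃ zc : L, zc ≠ 0 ∧ zc ∈ gr F L 1 ∧ centerSub F L = Submodule.span F {zc}

/-- `P ≅ L ⊕ M` as Lie superalgebras (internal direct sum of two commuting copies). -/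
def IsDirectSumOf (F : Type u) (P : Type v) (L : Type w) (M : Type x) [Field F]
    [AddCommGroup P] [Module F P] [SuperModule F P] [LieSuperAlgebra F P]
    [AddCommGroup L] [Module F L] [SuperModule F L] [LieSuperAlgebra F L]
    [AddCommGroup M] [Module F M] [SuperModule F M] [LieSuperAlgebra F M] : Prop :=
  ∃ (f : LieSuperHom F L P) (g : LieSuperHom F M P),
    Function.Bijective (fun q : L × M => f.toLinearMap q.1 + g.toLinearMap q.2) ∧
    (∀ (x : L) (y : M), br F P (f.toLinearMap x) (g.toLinearMap y) = 0) ∧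
    (∀ (y : M) (x : L), br F P (g.toLinearMap y) (f.toLinearMap x) = 0)

/-- `S ≅ A ⊕ B ⊕ C ⊕ D` as Lie superalgebras. -/
def IsDirectSumOf4 (F : Type u) (S : Type v) (A : Type w) (B : Type x) (C : Type y)
    (D : Type z) [Field F]
    [AddCommGroup S] [Module F S] [SuperModule F S] [LieSuperAlgebra F S]
    [AddCommGroup A] [Module F A] [SuperModule F A] [LieSuperAlgebra F A]
    [AddCommGroup B] [Module F B] [SuperModule F B] [LieSuperAlgebra F B]
    [AddCommGroup C] [Module F C] [SuperModule F C] [LieSuperAlgebra F C]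
    [AddCommGroup D] [Module F D] [SuperModule F D] [LieSuperAlgebra F D] : Prop :=
  ∃ (f : LieSuperHom F A S) (g : LieSuperHom F B S) (h : LieSuperHom F C S)
    (k : LieSuperHom F D S),
    Function.Bijective (fun q : A × B × C × D =>
      f.toLinearMap q.1 + g.toLinearMap q.2.1 + h.toLinearMap q.2.2.1
        + k.toLinearMap q.2.2.2) ∧
    (∀ u v', br F S (f.toLinearMap u) (g.toLinearMap v') = 0) ∧
    (∀ u v', br F S (f.toLinearMap u) (h.toLinearMap v') = 0) ∧
    (∀ u v', br F S (f.toLinearMap u) (k.toLinearMap v') = 0) ∧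
    (∀ u v', br F S (g.toLinearMap u) (h.toLinearMap v') = 0) ∧
    (∀ u v', br F S (g.toLinearMap u) (k.toLinearMap v') = 0) ∧
    (∀ u v', br F S (h.toLinearMap u) (k.toLinearMap v') = 0)

/-- `L ≅ H(m, n) ⊕ A(a | b)`: an internal decomposition into a Heisenberg part with
even center, spanned by homogeneous elements with the defining brackets, and a central
abelian graded complement of dimension `(a | b)`. -/
def DecompHeisenbergAbelian (F : Type u) (L : Type v) [Field F]
    [AddCommGroup L] [Module F L] [SuperModule F L] [LieSuperAlgebra F L]
    (m n a b : ℕ) : Prop :=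
  ∃ (xv : Fin (2 * m) → L) (yv : Fin n → L) (zv : L) (A : Submodule F L),
    (∀ i, xv i ∈ gr F L 0) ∧ (∀ j, yv j ∈ gr F L 1) ∧ zv ∈ gr F L 0 ∧
    IsGradedSub F A ∧
    finrank F (A ⊓ gr F L 0 : Submodule F L) = a ∧
    finrank F (A ⊓ gr F L 1 : Submodule F L) = b ∧
    (∀ u ∈ A, ∀ v : L, br F L u v = 0 ∧ br F L v u = 0) ∧
    LinearIndependent F (Sum.elim xv (Sum.elim yv (fun _ : Unit => zv))) ∧
    Disjoint (Submodule.span F (Set.range (Sum.elim xv (Sum.elim yv (fun _ : Unit => zv))))) A ∧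
    Submodule.span F (Set.range (Sum.elim xv (Sum.elim yv (fun _ : Unit => zv)))) ⊔ A = ⊤ ∧
    (∀ i j : Fin (2 * m), br F L (xv i) (xv j) =
      if (j : ℕ) = (i : ℕ) + m then zv else if (i : ℕ) = (j : ℕ) + m then -zv else 0) ∧
    (∀ (i : Fin (2 * m)) (j : Fin n), br F L (xv i) (yv j) = 0) ∧
    (∀ (j : Fin n) (i : Fin (2 * m)), br F L (yv j) (xv i) = 0) ∧
    (∀ j k : Fin n, br F L (yv j) (yv k) = if j = k then zv else 0) ∧
    (∀ i, br F L (xv i) zv = 0) ∧ (∀ i, br F L zv (xv i) = 0) ∧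
    (∀ j, br F L (yv j) zv = 0) ∧ (∀ j, br F L zv (yv j) = 0) ∧
    br F L zv zv = 0

/-- The submodule of a realization of `I ⊗ J` (for graded ideals `I, J` of `M`)
generated by `x ⊗ y + (-1)^(|x||y|) y ⊗ x` and `x₀ ⊗ x₀` for `x, y, x₀ ∈ I ∩ J`,
`x₀` even. -/
def pairBox (F : Type u) (I : Type v) (J : Type w) (TIJ : Type x) (M : Type y) [Field F]
    [AddCommGroup I] [Module F I] [SuperModule F I] [LieSuperAlgebra F I]
    [AddCommGroup J] [Module F J] [SuperModule F J] [LieSuperAlgebra F J]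
    [AddCommGroup TIJ] [Module F TIJ] [SuperModule F TIJ] [LieSuperAlgebra F TIJ]
    [AddCommGroup M] [Module F M] [SuperModule F M] [LieSuperAlgebra F M]
    (ι : LieSuperHom F I M) (κ : LieSuperHom F J M)
    (α : LieSuperAction F I J) (β : LieSuperAction F J I)
    (p : SuperPairing F I J TIJ α β) : Submodule F TIJ :=
  Submodule.span F
    ({t | ∃ (a b : ZMod 2) (i i' : I) (j j' : J),
        ι.toLinearMap i = κ.toLinearMap j ∧ ι.toLinearMap i' = κ.toLinearMap j' ∧
        ι.toLinearMap i ∈ gr F M a ∧ ι.toLinearMap i' ∈ gr F M b ∧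
        t = p.pair i j' + sgn F a b • p.pair i' j} ∪
      {t | ∃ (i : I) (j : J), ι.toLinearMap i = κ.toLinearMap j ∧
        ι.toLinearMap i ∈ gr F M 0 ∧ t = p.pair i j})

section Helpers

/-- Grading from an idempotent: even part is the fixed space, odd part the kernel. -/
def superOfIdem {F : Type u} {V : Type v} [Field F] [AddCommGroup V] [Module F V]
    (Q : V →ₗ[F] V) (hQ : ∀ x, Q (Q x) = Q x) : SuperModule F V where
  grade a := if a = 0 then LinearMap.ker (LinearMap.id - Q) else LinearMap.ker Q
  isCompl_grade := by
    simp only [if_true, one_ne_zero, if_false]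
    constructor
    · rw [Submodule.disjoint_def]
      intro x h0 h1
      simp only [LinearMap.mem_ker, LinearMap.sub_apply, LinearMap.id_apply] at h0 h1
      simpa [h1] using h0
    · rw [codisjoint_iff, eq_top_iff]
      intro x _
      refine Submodule.mem_sup.2 ⟨Q x, ?_, x - Q x, ?_, by simp⟩ <;> simp [hQ]

lemma mem_superOfIdem {F : Type u} {V : Type v} [Field F] [AddCommGroup V] [Module F V]
    (Q : V →ₗ[F] V) (hQ : ∀ x, Q (Q x) = Q x) (a : ZMod 2) (x : V) :
    x ∈ (superOfIdem Q hQ).grade a ↔ Q x = if a = 0 then x else 0 := by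
  change x ∈ (if a = 0 then LinearMap.ker (LinearMap.id - Q) else LinearMap.ker Q) ↔ _
  split_ifs
  · simp only [LinearMap.mem_ker, LinearMap.sub_apply, LinearMap.id_apply, sub_eq_zero]
    exact eq_comm
  · simp

/-- The even projector. -/
noncomputable def evP (F : Type u) (V : Type v) [Field F] [AddCommGroup V] [Module F V]
    [s : SuperModule F V] : V →ₗ[F] V := (s.grade 0).projection (s.grade 1) s.isCompl_grade

section
variable {F : Type u} {V : Type v} [Field F] [AddCommGroup V] [Module F V] [s : SuperModule F V]

lemma evP_mem (x : V) : evP F V x ∈ gr F V 0 := by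
  rw [evP, Submodule.projection_apply]
  exact Subtype.property _

lemma evP_of_zero {x : V} (h : x ∈ gr F V 0) : evP F V x = x := by
  exact Submodule.projection_apply_left s.isCompl_grade ⟨x, h⟩

lemma evP_of_one {x : V} (h : x ∈ gr F V 1) : evP F V x = 0 := by
  exact (Submodule.projection_apply_eq_zero_iff s.isCompl_grade).2 h

lemma sub_evP_mem (x : V) : x - evP F V x ∈ gr F V 1 := by
  rw [← Submodule.projection_apply_eq_zero_iff s.isCompl_grade]
  change evP F V (x - evP F V x) = 0
  rw [map_sub, evP_of_zero (evP_mem x), sub_self]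

lemma zmod2_cases (a : ZMod 2) : a = 0 ∨ a = 1 := by revert a; decide

lemma mem_gr_iff (a : ZMod 2) (x : V) : x ∈ gr F V a ↔ evP F V x = if a = 0 then x else 0 := by
  rcases zmod2_cases a with rfl | rfl
  · simp only [if_true]
    exact ⟨evP_of_zero, fun h => h ▸ evP_mem x⟩
  · simp only [one_ne_zero, if_false]
    refine ⟨evP_of_one, fun h => ?_⟩
    have := sub_evP_mem (F := F) x
    rwa [h, sub_zero] at this

lemma evP_idem (x : V) : evP F V (evP F V x) = evP F V x := evP_of_zero (evP_mem x)
end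

/-- Even projector of a graded bilinear map. -/
lemma evP_bil {F : Type u} {V : Type v} {W : Type w} {T : Type x} [Field F]
    [AddCommGroup V] [Module F V] [SuperModule F V]
    [AddCommGroup W] [Module F W] [SuperModule F W]
    [AddCommGroup T] [Module F T] [SuperModule F T]
    (b : V →ₗ[F] W →ₗ[F] T)
    (hb : ∀ (i j : ZMod 2) (m : V) (n : W), m ∈ gr F V i → n ∈ gr F W j → b m n ∈ gr F T (i + j))
    (m : V) (n : W) :
    evP F T (b m n) = b (evP F V m) (evP F W n) + b (m - evP F V m) (n - evP F W n) := by
  have h00 := evP_of_zero (by simpa using hb 0 0 _ _ (evP_mem m) (evP_mem n))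
  have h01 := evP_of_one (by
    have := hb 0 1 _ _ (evP_mem m) (sub_evP_mem n)
    rwa [zero_add] at this)
  have h10 := evP_of_one (by
    have := hb 1 0 _ _ (sub_evP_mem m) (evP_mem n)
    rwa [add_zero] at this)
  have h11 := evP_of_zero (by
    have := hb 1 1 _ _ (sub_evP_mem m) (sub_evP_mem n)
    rwa [show (1 + 1 : ZMod 2) = 0 from rfl] at this)
  have e : b m n = b (evP F V m) (evP F W n) + b (evP F V m) (n - evP F W n)
      + b (m - evP F V m) (evP F W n) + b (m - evP F V m) (n - evP F W n) := by
    simp only [map_sub, LinearMap.sub_apply]; abel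
  rw [e, map_add, map_add, map_add, h00, h01, h10, h11]; abel

/-- To prove a bilinear-type additive identity it suffices to check homogeneous elements. -/
lemma hom_decomp {F : Type u} {V : Type v} [Field F] [AddCommGroup V] [Module F V]
    [SuperModule F V] {P : V → Prop} (hadd : ∀ x y, P x → P y → P (x + y))
    (hh : ∀ (a : ZMod 2) (x : V), x ∈ gr F V a → P x) (x : V) : P x := by
  have := hadd _ _ (hh 0 _ (evP_mem (F := F) x)) (hh 1 _ (sub_evP_mem (F := F) x))
  simpa using this

lemma evP_derived {F : Type u} {L : Type v} [Field F] [AddCommGroup L] [Module F L]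
    [SuperModule F L] [LieSuperAlgebra F L] :
    derivedSub F L ≤ (derivedSub F L).comap (evP F L) := by
  refine Submodule.span_le.2 ?_
  rintro _ ⟨x, y, rfl⟩
  change evP F L (br F L x y) ∈ derivedSub F L
  rw [evP_bil (br F L) LieSuperAlgebra.bracket_grade]
  exact add_mem (Submodule.subset_span ⟨_, _, rfl⟩) (Submodule.subset_span ⟨_, _, rfl⟩)

/-- The even projector on the abelianization. -/
noncomputable def abP (F : Type u) (L : Type v) [Field F] [AddCommGroup L] [Module F L]
    [SuperModule F L] [LieSuperAlgebra F L] :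
    (L ⧸ derivedSub F L) →ₗ[F] (L ⧸ derivedSub F L) :=
  (derivedSub F L).mapQ (derivedSub F L) (evP F L) evP_derived

lemma abP_mk {F : Type u} {L : Type v} [Field F] [AddCommGroup L] [Module F L]
    [SuperModule F L] [LieSuperAlgebra F L] (x : L) :
    abP F L ((derivedSub F L).mkQ x) = (derivedSub F L).mkQ (evP F L x) := rfl

/-- Transfer of grading along ULift. -/
def uliftSuper (F : Type u) (V : Type v) [Field F] [AddCommGroup V] [Module F V]
    [s : SuperModule F V] : SuperModule F (ULift.{w} V) where
  grade a := (s.grade a).comap (ULift.moduleEquiv : ULift.{w} V ≃ₗ[F] V).toLinearMap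
  isCompl_grade := by
    constructor
    · rw [Submodule.disjoint_def]
      intro x h0 h1
      apply ULift.down_injective
      exact (Submodule.disjoint_def.1 s.isCompl_grade.disjoint) _ h0 h1
    · rw [codisjoint_iff, eq_top_iff]
      intro x _
      exact Submodule.mem_sup.2 ⟨⟨evP F V x.down⟩, evP_mem (F := F) x.down,
        ⟨x.down - evP F V x.down⟩, sub_evP_mem (F := F) x.down,
        ULift.down_injective (by simp)⟩

/-- Transfer of the Lie structure along ULift. -/
def uliftLie (F : Type u) (V : Type v) [Field F] [AddCommGroup V] [Module F V]
    [SuperModule F V] [s : LieSuperAlgebra F V] :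
    @LieSuperAlgebra F (ULift.{w} V) _ _ _ (uliftSuper F V) :=
  letI := uliftSuper.{u, v, w} F V
  { bracket := LinearMap.mk₂ F (fun x y => ULift.up (s.bracket x.down y.down))
      (by intros; apply ULift.down_injective; simp)
      (by intros; apply ULift.down_injective; simp)
      (by intros; apply ULift.down_injective; simp)
      (by intros; apply ULift.down_injective; simp)
    bracket_grade := fun a b x y hx hy => s.bracket_grade a b x.down y.down hx hy
    skew := fun a b x y hx hy => ULift.down_injective (s.skew a b x.down y.down hx hy)
    jacobi := fun a b c x y z hx hy hz =>
      ULift.down_injective (s.jacobi a b c x.down y.down z.down hx hy hz) }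

/-- Universal property with targets in a smaller universe. -/
lemma tensor_univ {F : Type u} {M : Type v} {N : Type w} {T : Type x} {T' : Type y} [Field F]
    [AddCommGroup M] [Module F M] [SuperModule F M] [LieSuperAlgebra F M]
    [AddCommGroup N] [Module F N] [SuperModule F N] [LieSuperAlgebra F N]
    [AddCommGroup T] [Module F T] [SuperModule F T] [LieSuperAlgebra F T]
    [AddCommGroup T'] [Module F T'] [SuperModule F T'] [LieSuperAlgebra F T']
    {α : LieSuperAction F M N} {β : LieSuperAction F N M}
    (p : SuperPairing F M N T α β)
    (hU : ∀ [SuperModule F (ULift.{max u v w x} T')] [LieSuperAlgebra F (ULift.{max u v w x} T')]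
      (q : SuperPairing F M N (ULift.{max u v w x} T') α β),
      ∃! h : LieSuperHom F T (ULift.{max u v w x} T'),
        ∀ (m : M) (n : N), h.toLinearMap (p.pair m n) = q.pair m n)
    (q : SuperPairing F M N T' α β) :
    (∃ h : LieSuperHom F T T', ∀ (m : M) (n : N), h.toLinearMap (p.pair m n) = q.pair m n) ∧
    (∀ h h' : LieSuperHom F T T',
      (∀ (m : M) (n : N), h.toLinearMap (p.pair m n) = q.pair m n) →
      (∀ (m : M) (n : N), h'.toLinearMap (p.pair m n) = q.pair m n) → ∀ t,
      h.toLinearMap t = h'.toLinearMap t) := by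
  letI := uliftSuper.{u, y, max u v w x} F T'
  letI := uliftLie.{u, y, max u v w x} F T'
  let up : T' →ₗ[F] ULift.{max u v w x} T' := ULift.moduleEquiv.symm.toLinearMap
  let dn : ULift.{max u v w x} T' →ₗ[F] T' := ULift.moduleEquiv.toLinearMap
  let q' : SuperPairing F M N (ULift.{max u v w x} T') α β :=
    { pair := q.pair.compr₂ up
      pair_grade := fun a b m n hm hn => q.pair_grade a b m n hm hn
      rel1 := fun a b m m' n hm hm' => ULift.down_injective (q.rel1 a b m m' n hm hm')
      rel2 := fun a b c m n n' hm hn hn' =>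
        ULift.down_injective (q.rel2 a b c m n n' hm hn hn')
      rel3 := fun a b m n m' n' hm hn => ULift.down_injective (q.rel3 a b m n m' n' hm hn) }
  obtain ⟨h, hh, huniq⟩ := hU q'
  refine ⟨⟨{ toLinearMap := dn ∘ₗ h.toLinearMap
             map_grade := fun a x hx => h.map_grade a x hx
             map_bracket := fun x y => congrArg ULift.down (h.map_bracket x y) },
    fun m n => congrArg ULift.down (hh m n)⟩, ?_⟩
  intro h1 h2 e1 e2 t
  let lf : LieSuperHom F T T' → LieSuperHom F T (ULift.{max u v w x} T') := fun k =>
    { toLinearMap := up ∘ₗ k.toLinearMap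
      map_grade := fun a x hx => k.map_grade a x hx
      map_bracket := fun x y => ULift.down_injective (k.map_bracket x y) }
  have k1 := huniq (lf h1) (fun m n => ULift.down_injective (e1 m n))
  have k2 := huniq (lf h2) (fun m n => ULift.down_injective (e2 m n))
  have : lf h1 = lf h2 := k1.trans k2.symm
  exact congrArg (fun k : LieSuperHom F T (ULift.{max u v w x} T') => (k.toLinearMap t).down) this

/-- The abelian Lie superalgebra structure. -/
def zeroLie (F : Type u) (V : Type v) [Field F] [AddCommGroup V] [Module F V]
    [SuperModule F V] : LieSuperAlgebra F V where
  bracket := 0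
  bracket_grade := by intros; simp
  skew := by intros; simp
  jacobi := by intros; simp

/-- Even projector on the tensor product of abelianizations. -/
noncomputable def tenP (F : Type u) (M : Type v) (N : Type w) [Field F]
    [AddCommGroup M] [Module F M] [SuperModule F M] [LieSuperAlgebra F M]
    [AddCommGroup N] [Module F N] [SuperModule F N] [LieSuperAlgebra F N] :
    ((M ⧸ derivedSub F M) ⊗[F] (N ⧸ derivedSub F N)) →ₗ[F]
      ((M ⧸ derivedSub F M) ⊗[F] (N ⧸ derivedSub F N)) :=
  TensorProduct.map (abP F M) (abP F N) +
    TensorProduct.map (LinearMap.id - abP F M) (LinearMap.id - abP F N)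

section
variable {F : Type u} {M : Type v} {N : Type w} [Field F]
    [AddCommGroup M] [Module F M] [SuperModule F M] [LieSuperAlgebra F M]
    [AddCommGroup N] [Module F N] [SuperModule F N] [LieSuperAlgebra F N]

lemma tenP_mk (m : M) (n : N) :
    tenP F M N ((derivedSub F M).mkQ m ⊗ₜ[F] (derivedSub F N).mkQ n) =
      (derivedSub F M).mkQ (evP F M m) ⊗ₜ[F] (derivedSub F N).mkQ (evP F N n) +
      (derivedSub F M).mkQ (m - evP F M m) ⊗ₜ[F] (derivedSub F N).mkQ (n - evP F N n) := by
  simp only [tenP, LinearMap.add_apply, TensorProduct.map_tmul, LinearMap.sub_apply,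
    LinearMap.id_apply, abP_mk, map_sub]

lemma ten_ext {W : Type x} [AddCommGroup W] [Module F W]
    {f g : ((M ⧸ derivedSub F M) ⊗[F] (N ⧸ derivedSub F N)) →ₗ[F] W}
    (h : ∀ m n, f ((derivedSub F M).mkQ m ⊗ₜ[F] (derivedSub F N).mkQ n) =
      g ((derivedSub F M).mkQ m ⊗ₜ[F] (derivedSub F N).mkQ n)) : f = g := by
  apply TensorProduct.ext'
  intro a b
  obtain ⟨m, rfl⟩ := (derivedSub F M).mkQ_surjective a
  obtain ⟨n, rfl⟩ := (derivedSub F N).mkQ_surjective b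
  exact h m n

lemma tenP_idem (t) : tenP F M N (tenP F M N t) = tenP F M N t := by
  have : tenP F M N ∘ₗ tenP F M N = tenP F M N := by
    apply ten_ext
    intro m n
    rw [LinearMap.comp_apply, tenP_mk, map_add, tenP_mk, tenP_mk]
    simp [evP_idem]
  exact LinearMap.congr_fun this t
end

lemma main_aux {F : Type u} {M : Type v} {N : Type w} {T : Type x} [Field F]
    [AddCommGroup M] [Module F M] [SuperModule F M] [LieSuperAlgebra F M]
    [AddCommGroup N] [Module F N] [SuperModule F N] [LieSuperAlgebra F N]
    (α : LieSuperAction F M N) (β : LieSuperAction F N M)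
    (hα : α.IsTrivial) (hβ : β.IsTrivial)
    [AddCommGroup T] [Module F T] [SuperModule F T] [LieSuperAlgebra F T]
    (p : SuperPairing F M N T α β) (hT : IsTensorProductLSA F M N T α β p) :
    ∃ e : T ≃ₗ[F] ((M ⧸ derivedSub F M) ⊗[F] (N ⧸ derivedSub F N)),
      ∀ (m : M) (n : N), e (p.pair m n)
        = (derivedSub F M).mkQ m ⊗ₜ[F] (derivedSub F N).mkQ n := by
  letI : SuperModule F ((M ⧸ derivedSub F M) ⊗[F] (N ⧸ derivedSub F N)) :=
    superOfIdem (tenP F M N) tenP_idem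
  letI : LieSuperAlgebra F ((M ⧸ derivedSub F M) ⊗[F] (N ⧸ derivedSub F N)) := zeroLie F _
  have mkM0 : ∀ x y : M, (derivedSub F M).mkQ (br F M x y) = 0 := fun x y =>
    (Submodule.Quotient.mk_eq_zero _).2 (Submodule.subset_span ⟨x, y, rfl⟩)
  have mkN0 : ∀ x y : N, (derivedSub F N).mkQ (br F N x y) = 0 := fun x y =>
    (Submodule.Quotient.mk_eq_zero _).2 (Submodule.subset_span ⟨x, y, rfl⟩)
  let q : SuperPairing F M N ((M ⧸ derivedSub F M) ⊗[F] (N ⧸ derivedSub F N)) α β :=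
    { pair := (TensorProduct.mk F _ _).compl₁₂ (derivedSub F M).mkQ (derivedSub F N).mkQ
      pair_grade := by
        intro a b m n hm hn
        rw [mem_gr_iff] at hm hn
        refine (mem_superOfIdem _ _ _ _).2 ?_
        simp only [LinearMap.compl₁₂_apply, TensorProduct.mk_apply, tenP_mk, hm, hn]
        rcases zmod2_cases a with rfl | rfl <;> rcases zmod2_cases b with rfl | rfl <;>
          simp [show (1 + 1 : ZMod 2) = 0 from rfl]
      rel1 := by
        intro a b m m' n _ _
        rw [hα, hα]
        simp only [LinearMap.compl₁₂_apply, mkM0]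
        simp
      rel2 := by
        intro a b c m n n' _ _ _
        rw [hβ, hβ]
        simp only [LinearMap.compl₁₂_apply, mkN0]
        simp
      rel3 := by
        intro a b m n m' n' _ _
        rw [hβ, hα]
        simp only [map_zero, smul_zero]
        rfl }
  obtain ⟨⟨h, hh⟩, -⟩ := tensor_univ p (fun q => hT _ q) q
  -- the pairing kills derived subalgebras
  have pM : ∀ (m m' : M) (n : N), p.pair (br F M m m') n = 0 := by
    intro m m' n
    refine hom_decomp (F := F) (P := fun m => p.pair (br F M m m') n = 0) ?_ ?_ m
    · intro x y hx hy; simp [hx, hy]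
    intro a m hm
    refine hom_decomp (F := F) (P := fun m' => p.pair (br F M m m') n = 0) ?_ ?_ m'
    · intro x y hx hy; simp [hx, hy]
    intro b m' hm'
    rw [p.rel1 a b m m' n hm hm', hα, hα]; simp
  have pN : ∀ (m : M) (n n' : N), p.pair m (br F N n n') = 0 := by
    intro m n n'
    refine hom_decomp (F := F) (P := fun m => p.pair m (br F N n n') = 0) ?_ ?_ m
    · intro x y hx hy; simp [hx, hy]
    intro a m hm
    refine hom_decomp (F := F) (P := fun n => p.pair m (br F N n n') = 0) ?_ ?_ n
    · intro x y hx hy; simp [hx, hy]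
    intro b n hn
    refine hom_decomp (F := F) (P := fun n' => p.pair m (br F N n n') = 0) ?_ ?_ n'
    · intro x y hx hy; simp [hx, hy]
    intro c n' hn'
    rw [p.rel2 a b c m n n' hm hn hn', hβ, hβ]; simp
  have pB : ∀ (m : M) (n : N) (m' : M) (n' : N), br F T (p.pair m n) (p.pair m' n') = 0 := by
    intro m n m' n'
    refine hom_decomp (F := F) (P := fun m => br F T (p.pair m n) (p.pair m' n') = 0) ?_ ?_ m
    · intro x y hx hy; simp [hx, hy]
    intro a m hm
    refine hom_decomp (F := F) (P := fun n => br F T (p.pair m n) (p.pair m' n') = 0) ?_ ?_ n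
    · intro x y hx hy; simp [hx, hy]
    intro b n hn
    rw [p.rel3 a b m n m' n' hm hn, hβ]; simp
  have kM : derivedSub F M ≤ LinearMap.ker p.pair := by
    refine Submodule.span_le.2 ?_
    rintro _ ⟨x, y, rfl⟩
    exact LinearMap.ext fun n => pM x y n
  have kN : derivedSub F N ≤
      LinearMap.ker ((derivedSub F M).liftQ p.pair kM).flip := by
    refine Submodule.span_le.2 ?_
    rintro _ ⟨x, y, rfl⟩
    refine LinearMap.ext fun a => ?_
    obtain ⟨m, rfl⟩ := (derivedSub F M).mkQ_surjective a
    exact pN m x y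
  let g : ((M ⧸ derivedSub F M) ⊗[F] (N ⧸ derivedSub F N)) →ₗ[F] T :=
    TensorProduct.lift
      ((derivedSub F N).liftQ ((derivedSub F M).liftQ p.pair kM).flip kN).flip
  have hg : ∀ m n, g ((derivedSub F M).mkQ m ⊗ₜ[F] (derivedSub F N).mkQ n) = p.pair m n :=
    fun m n => rfl
  have hgP : ∀ t, evP F T (g t) = g (tenP F M N t) := by
    intro t
    have : evP F T ∘ₗ g = g ∘ₗ tenP F M N := by
      apply ten_ext
      intro m n
      simp only [LinearMap.comp_apply, tenP_mk, map_add, hg]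
      exact evP_bil p.pair p.pair_grade m n
    exact LinearMap.congr_fun this t
  have hgB : ∀ s t, br F T (g s) (g t) = 0 := by
    intro s t
    have : (br F T).compl₁₂ g g = 0 := by
      apply ten_ext
      intro m n
      apply ten_ext
      intro m' n'
      simp only [LinearMap.compl₁₂_apply, hg, pB]
      simp
    exact LinearMap.congr_fun (LinearMap.congr_fun this s) t
  let k : LieSuperHom F T T :=
    { toLinearMap := g ∘ₗ h.toLinearMap
      map_grade := by
        intro a x hx
        have h1 := (mem_superOfIdem _ _ _ _).1 (h.map_grade a x hx)
        rw [mem_gr_iff, LinearMap.comp_apply, hgP, h1]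
        split_ifs <;> simp
      map_bracket := by
        intro x y
        rw [LinearMap.comp_apply, LinearMap.comp_apply, LinearMap.comp_apply, hgB,
          h.map_bracket]
        exact map_zero g }
  let i : LieSuperHom F T T :=
    { toLinearMap := LinearMap.id
      map_grade := fun a x hx => hx
      map_bracket := fun x y => rfl }
  have hgh : ∀ t, g (h.toLinearMap t) = t :=
    (tensor_univ p (fun q => hT _ q) p).2 k i
      (fun m n => by
        change g (h.toLinearMap (p.pair m n)) = _
        rw [hh]; exact hg m n)
      (fun m n => rfl)
  have hhg : h.toLinearMap ∘ₗ g = LinearMap.id := by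
    apply ten_ext
    intro m n
    rw [LinearMap.comp_apply, hg, hh]; rfl
  exact ⟨LinearEquiv.ofLinearMap h.toLinearMap g hhg (LinearMap.ext hgh), fun m n => hh m n⟩

end Helpers

theorem stmt_9 (F : Type*) [Field F] (hchar2 : ringChar F ≠ 2) (hchar3 : ringChar F ≠ 3)
    (M : Type*) [AddCommGroup M] [Module F M] [SuperModule F M] [LieSuperAlgebra F M]
    (N : Type*) [AddCommGroup N] [Module F N] [SuperModule F N] [LieSuperAlgebra F N]
    (α : LieSuperAction F M N) (β : LieSuperAction F N M)
    (hα : α.IsTrivial) (hβ : β.IsTrivial)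
    (T : Type*) [AddCommGroup T] [Module F T] [SuperModule F T] [LieSuperAlgebra F T]
    (p : SuperPairing F M N T α β) (hT : IsTensorProductLSA F M N T α β p) :
    ∃ e : T ≃ₗ[F] ((M ⧸ derivedSub F M) ⊗[F] (N ⧸ derivedSub F N)),
      ∀ (m : M) (n : N), e (p.pair m n)
        = (derivedSub F M).mkQ m ⊗ₜ[F] (derivedSub F N).mkQ n := by
  exact main_aux α β hα hβ p hT
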